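/- Let w be a hyperbolic isometry of E = ℝⁿ of maximal reflection length ℓ(w) = n + 1. Then every reflection r of E lies in the interval [1,w]; that is, ℓ(rw) = n for every reflection r. -/

import Mathlib

open scoped RealInnerProductSpace

noncomputable section

/-- `n`-dimensional euclidean space `E = ℝⁿ` (also used as the vector space `V` of
translations). -/
abbrev Euc (n : ℕ) := EuclideanSpace ℝ (Fin n)

/-- An isometry of `E`: a surjective distance-preserving map of `E` to itself
(such a map is automatically an affine bijection). -/
abbrev Iso (n : ℕ) := Euc n ≃ᵢ Euc n

/-- The move-set `Mov(w) = { w(x) - x : x ∈ E } ⊆ V`. -/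
def MovSet (n : ℕ) (w : Iso n) : Set (Euc n) := {v | ∃ x, w x - x = v}

/-- The fix-set `Fix(w) = { x ∈ E : w(x) = x }`. -/
def FixSet (n : ℕ) (w : Iso n) : Set (Euc n) := {x | w x = x}

/-- A reflection: a nontrivial isometry fixing pointwise an affine hyperplane,
i.e. a nonempty affine subspace of codimension one. -/
def IsReflection (n : ℕ) (r : Iso n) : Prop :=
  r ≠ 1 ∧ ∃ H : AffineSubspace ℝ (Euc n), (H : Set (Euc n)).Nonempty ∧
    Module.finrank ℝ H.direction + 1 = n ∧ ∀ x ∈ H, r x = x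

/-- The reflection length `ℓ(w)`: the least `k` such that `w` is a product of `k`
reflections. -/
def reflLen (n : ℕ) (w : Iso n) : ℕ :=
  sInf {k | ∃ l : List (Iso n), l.length = k ∧ (∀ r ∈ l, IsReflection n r) ∧ l.prod = w}

/-- `u` lies in the interval `[1, w]`:  `ℓ(u) + ℓ(u⁻¹w) = ℓ(w)`. -/
def inInterval (n : ℕ) (w u : Iso n) : Prop :=
  reflLen n u + reflLen n (u⁻¹ * w) = reflLen n w

/-- The betweenness partial order on the interval `[1, w]`:
`u ≤ v` iff `ℓ(u) + ℓ(u⁻¹v) + ℓ(v⁻¹w) = ℓ(w)`. -/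
def intervalLE (n : ℕ) (w u v : Iso n) : Prop :=
  reflLen n u + reflLen n (u⁻¹ * v) + reflLen n (v⁻¹ * w) = reflLen n w

/-- The set of directions `Dir(S) = { m - m' : m, m' ∈ S }` of a subset `S`. -/
def dirSet (n : ℕ) (S : Set (Euc n)) : Set (Euc n) := {d | ∃ m ∈ S, ∃ m' ∈ S, d = m - m'}

/-- `α` is a root of the reflection `r`: a nonzero vector orthogonal to the
direction space of the fixed hyperplane of `r`. -/
def IsRoot (n : ℕ) (r : Iso n) (α : Euc n) : Prop :=
  α ≠ 0 ∧ ∀ x y : Euc n, r x = x → r y = y → ⟪α, y - x⟫ = 0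

open Module Submodule

/-- A linear isometry fixing a hyperplane pointwise is the identity or the reflection in it. -/
theorem LinearIsometryEquiv.eq_reflection_of_fixes_hyperplane {F : Type*}
    [NormedAddCommGroup F] [InnerProductSpace ℝ F] [FiniteDimensional ℝ F]
    (φ : F ≃ₗᵢ[ℝ] F) (K : Submodule ℝ F) (hK : finrank ℝ K + 1 = finrank ℝ F)
    (hfix : ∀ k ∈ K, φ k = k) (hne : φ ≠ 1) : φ = K.reflection := by
  have hspan : ∀ v, φ v ≠ v → (ℝ ∙ (v - φ v))ᗮ = K := by
    intro v hv
    have hu : v - φ v ≠ 0 := sub_ne_zero.mpr (Ne.symm hv)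
    symm
    apply Submodule.eq_of_le_of_finrank_eq
    · intro k hk
      rw [Submodule.mem_orthogonal_singleton_iff_inner_left, inner_sub_right]
      nth_rewrite 2 [← hfix k hk]
      rw [φ.inner_map_map, sub_self]
    · have h := (ℝ ∙ (v - φ v)).finrank_add_finrank_orthogonal
      rw [finrank_span_singleton hu] at h
      omega
  obtain ⟨v, hv⟩ : ∃ v, φ v ≠ v := by
    by_contra! h
    exact hne (LinearIsometryEquiv.ext h)
  ext1 x
  by_cases hx : φ x = x
  · have hxK : x ∈ K := by
      rw [← hspan v hv, Submodule.mem_orthogonal_singleton_iff_inner_left, inner_sub_right]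
      nth_rewrite 2 [← hx]
      rw [φ.inner_map_map, sub_self]
    rw [hx, reflection_mem_subspace_eq_self hxK]
  · have h := reflection_sub (φ.norm_map x).symm
    simp only [hspan x hx] at h
    exact h.symm

/-- The linear part of an isometry of `E`. -/
def linearPart (n : ℕ) : Iso n →* (Euc n ≃ₗᵢ[ℝ] Euc n) where
  toFun g := g.toRealAffineIsometryEquiv.linearIsometryEquiv
  map_one' := by
    ext1 v
    simpa using (1 : Iso n).toRealAffineIsometryEquiv.map_vsub v 0
  map_mul' g h := by
    ext1 v
    have h₁ := (g * h).toRealAffineIsometryEquiv.map_vsub v 0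
    have h₂ := g.toRealAffineIsometryEquiv.map_vsub (h v) (h 0)
    have h₃ := h.toRealAffineIsometryEquiv.map_vsub v 0
    simp only [IsometryEquiv.coeFn_toRealAffineIsometryEquiv, vsub_eq_sub, sub_zero,
      IsometryEquiv.mul_apply] at h₁ h₂ h₃
    rw [LinearIsometryEquiv.coe_mul, Function.comp_apply, h₁, h₃, h₂]

theorem linearPart_sub (n : ℕ) (g : Iso n) (x y : Euc n) :
    linearPart n g (x - y) = g x - g y :=
  g.toRealAffineIsometryEquiv.map_vsub x y

/-- The isometry fixing `p` with a prescribed linear part. -/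
def linearAt (n : ℕ) (p : Euc n) : (Euc n ≃ₗᵢ[ℝ] Euc n) →* Iso n where
  toFun φ := (IsometryEquiv.addRight (-p)).trans
    (φ.toIsometryEquiv.trans (IsometryEquiv.addRight p))
  map_one' := by ext1 x; simp
  map_mul' φ ψ := by ext1 x; simp

theorem linearAt_apply (n : ℕ) (p : Euc n) (φ : Euc n ≃ₗᵢ[ℝ] Euc n) (x : Euc n) :
    linearAt n p φ x = φ (x - p) + p := by
  simp [linearAt, sub_eq_add_neg]

theorem linearAt_linearPart {n : ℕ} {g : Iso n} {p : Euc n} (h : g p = p) :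
    linearAt n p (linearPart n g) = g := by
  ext1 x
  rw [linearAt_apply, linearPart_sub, h, sub_add_cancel]

theorem isReflection_linearAt {n : ℕ} (p : Euc n) {v : Euc n} (hv : v ≠ 0) :
    IsReflection n (linearAt n p (ℝ ∙ v)ᗮ.reflection) := by
  refine ⟨fun h => ?_, AffineSubspace.mk' p (ℝ ∙ v)ᗮ, ⟨p, AffineSubspace.self_mem_mk' _ _⟩, ?_, ?_⟩
  · have h₁ := DFunLike.congr_fun h (v + p)
    rw [linearAt_apply, add_sub_cancel_right, reflection_orthogonalComplement_singleton_eq_neg,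
      IsometryEquiv.coe_one, id_eq, add_left_inj] at h₁
    have := IsAddTorsionFree.of_module_rat (Euc n)
    exact hv (_root_.neg_eq_self.mp h₁)
  · have h := (ℝ ∙ v).finrank_add_finrank_orthogonal
    rw [finrank_span_singleton hv, finrank_euclideanSpace_fin] at h
    rw [AffineSubspace.direction_mk']
    omega
  · intro x hx
    rw [AffineSubspace.mem_mk', vsub_eq_sub] at hx
    rw [linearAt_apply, reflection_mem_subspace_eq_self hx, sub_add_cancel]

theorem IsReflection.inv {n : ℕ} {r : Iso n} (hr : IsReflection n r) : IsReflection n r⁻¹ := by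
  obtain ⟨h1, H, hH, hdim, hfix⟩ := hr
  refine ⟨inv_ne_one.mpr h1, H, hH, hdim, fun x hx => ?_⟩
  nth_rewrite 1 [← hfix x hx]
  exact r.symm_apply_apply x

theorem IsReflection.det_linearPart {n : ℕ} {r : Iso n} (hr : IsReflection n r) :
    LinearEquiv.det (linearPart n r).toLinearEquiv = -1 := by
  obtain ⟨h1, H, ⟨p, hp⟩, hdim, hfix⟩ := hr
  have hF : finrank ℝ (Euc n) = n := finrank_euclideanSpace_fin
  have hφ : linearPart n r = H.direction.reflection := by
    apply LinearIsometryEquiv.eq_reflection_of_fixes_hyperplane _ _ (hdim.trans hF.symm)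
    · intro k hk
      have h := linearPart_sub n r (k +ᵥ p) p
      rw [hfix p hp, hfix _ (AffineSubspace.vadd_mem_of_mem_direction hk hp)] at h
      simpa using h
    · intro h
      apply h1
      rw [← linearAt_linearPart (hfix p hp), h, map_one]
  have h := H.direction.finrank_add_finrank_orthogonal
  have h' : finrank ℝ H.directionᗮ = 1 := by omega
  rw [hφ, Submodule.linearEquiv_det_reflection, h', pow_one]

theorem det_linearPart_prod {n : ℕ} (l : List (Iso n)) (hl : ∀ r ∈ l, IsReflection n r) :
    LinearEquiv.det (linearPart n l.prod).toLinearEquiv = (-1) ^ l.length := by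
  induction l with
  | nil =>
    rw [List.prod_nil, map_one]
    exact map_one LinearEquiv.det
  | cons r l ih =>
    rw [List.forall_mem_cons] at hl
    rw [List.prod_cons, map_mul, List.length_cons, pow_succ', ← ih hl.2, ← hl.1.det_linearPart]
    exact map_mul LinearEquiv.det _ _

theorem exists_reflections_of_fixed_point {n : ℕ} {g : Iso n} {p : Euc n} (hp : g p = p) :
    ∃ l : List (Iso n), l.length ≤ n ∧ (∀ r ∈ l, IsReflection n r) ∧ l.prod = g := by
  obtain ⟨l, hl, hφ⟩ := (linearPart n g).reflections_generate_dim
  rw [finrank_euclideanSpace_fin] at hl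
  have key : ∀ l : List (Euc n), ∃ l' : List (Iso n), l'.length ≤ l.length ∧
      (∀ r ∈ l', IsReflection n r) ∧
      l'.prod = linearAt n p (l.map fun v => (ℝ ∙ v)ᗮ.reflection).prod := by
    intro l
    induction l with
    | nil => exact ⟨[], le_rfl, by simp, by simp⟩
    | cons v l ih =>
      obtain ⟨l', hlen, hrefl, hprod⟩ := ih
      rw [List.map_cons, List.prod_cons, map_mul, ← hprod]
      by_cases hv : v = 0
      · refine ⟨l', hlen.trans (Nat.le_succ _), hrefl, ?_⟩
        have h : (ℝ ∙ v)ᗮ.reflection = 1 := by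
          ext1 x
          exact reflection_mem_subspace_eq_self (by simp [hv])
        rw [h, map_one, one_mul]
      · exact ⟨linearAt n p (ℝ ∙ v)ᗮ.reflection :: l', Nat.succ_le_succ hlen,
          List.forall_mem_cons.mpr ⟨isReflection_linearAt p hv, hrefl⟩, List.prod_cons⟩
  obtain ⟨l', hlen, hrefl, hprod⟩ := key l
  exact ⟨l', hlen.trans hl, hrefl, by rw [hprod, ← hφ, linearAt_linearPart hp]⟩

theorem exists_reflections {n : ℕ} (g : Iso n) :
    ∃ l : List (Iso n), l.length ≤ n + 1 ∧ (∀ r ∈ l, IsReflection n r) ∧ l.prod = g := by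
  by_cases h : g 0 = 0
  · obtain ⟨l, hlen, hl⟩ := exists_reflections_of_fixed_point h
    exact ⟨l, by omega, hl⟩
  · set m : Euc n := (2⁻¹ : ℝ) • g 0 with hm
    set s := linearAt n m (ℝ ∙ (g 0))ᗮ.reflection with hs_def
    have hs : IsReflection n s := isReflection_linearAt m h
    have hfix : (s * g) 0 = 0 := by
      have h₁ : g 0 - m = m := by rw [hm]; module
      have h₂ : (ℝ ∙ (g 0))ᗮ.reflection m = -m := by
        rw [hm, map_smul, reflection_orthogonalComplement_singleton_eq_neg, smul_neg]
      rw [IsometryEquiv.mul_apply, hs_def, linearAt_apply, h₁, h₂, neg_add_cancel]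
    obtain ⟨l, hlen, hl, hprod⟩ := exists_reflections_of_fixed_point hfix
    exact ⟨s⁻¹ :: l, Nat.succ_le_succ hlen, List.forall_mem_cons.mpr ⟨hs.inv, hl⟩,
      by rw [List.prod_cons, hprod, inv_mul_cancel_left]⟩

theorem reflLen_le {n : ℕ} (l : List (Iso n)) (hl : ∀ r ∈ l, IsReflection n r) :
    reflLen n l.prod ≤ l.length :=
  Nat.sInf_le ⟨l, rfl, hl, rfl⟩

theorem exists_reflections_length_eq_reflLen {n : ℕ} (g : Iso n) :
    ∃ l : List (Iso n), l.length = reflLen n g ∧ (∀ r ∈ l, IsReflection n r) ∧ l.prod = g := by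
  obtain ⟨l, -, hl, hprod⟩ := exists_reflections g
  exact Nat.sInf_mem (s := {k | ∃ l : List (Iso n), l.length = k ∧
    (∀ r ∈ l, IsReflection n r) ∧ l.prod = g}) ⟨l.length, l, rfl, hl, hprod⟩

theorem reflLen_le_succ {n : ℕ} (g : Iso n) : reflLen n g ≤ n + 1 := by
  obtain ⟨l, hlen, hl, rfl⟩ := exists_reflections g
  exact (reflLen_le l hl).trans hlen

theorem det_linearPart_eq_neg_one_pow_reflLen {n : ℕ} (g : Iso n) :
    LinearEquiv.det (linearPart n g).toLinearEquiv = (-1) ^ reflLen n g := by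
  obtain ⟨l, hlen, hl, rfl⟩ := exists_reflections_length_eq_reflLen g
  rw [det_linearPart_prod l hl, hlen]

theorem IsReflection.reflLen_eq_one {n : ℕ} {r : Iso n} (hr : IsReflection n r) :
    reflLen n r = 1 := by
  apply le_antisymm
  · simpa using reflLen_le [r] (by simpa using hr)
  · by_contra! h
    obtain ⟨l, hlen, -, hprod⟩ := exists_reflections_length_eq_reflLen r
    rw [Nat.lt_one_iff.mp h, List.length_eq_zero_iff] at hlen
    exact hr.1 (by rw [← hprod, hlen, List.prod_nil])

theorem IsReflection.reflLen_le_reflLen_mul {n : ℕ} {r : Iso n} (hr : IsReflection n r)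
    (g : Iso n) : reflLen n g ≤ reflLen n (r * g) + 1 := by
  obtain ⟨l, hlen, hl, hprod⟩ := exists_reflections_length_eq_reflLen (r * g)
  have h := reflLen_le (r⁻¹ :: l) (List.forall_mem_cons.mpr ⟨hr.inv, hl⟩)
  rwa [List.prod_cons, hprod, inv_mul_cancel_left, List.length_cons, hlen] at h

theorem IsReflection.reflLen_mul_ne {n : ℕ} {r : Iso n} (hr : IsReflection n r) (g : Iso n) :
    reflLen n (r * g) ≠ reflLen n g := by
  intro h
  have h₁ : LinearEquiv.det (linearPart n (r * g)).toLinearEquiv =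
      LinearEquiv.det (linearPart n r).toLinearEquiv *
        LinearEquiv.det (linearPart n g).toLinearEquiv := by
    rw [map_mul]
    exact map_mul LinearEquiv.det _ _
  rw [det_linearPart_eq_neg_one_pow_reflLen, h, ← det_linearPart_eq_neg_one_pow_reflLen g,
    hr.det_linearPart, eq_comm, mul_eq_right] at h₁
  have h₂ := congrArg Units.val h₁
  norm_num at h₂

theorem IsReflection.reflLen_mul_of_reflLen_eq_succ {n : ℕ} {r : Iso n} (hr : IsReflection n r)
    {w : Iso n} (hw : reflLen n w = n + 1) : reflLen n (r * w) = n := by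
  have h₁ := hr.reflLen_le_reflLen_mul w
  have h₂ := hr.reflLen_mul_ne w
  have h₃ := reflLen_le_succ (r * w)
  omega

/-- for `w` hyperbolic of maximal reflection length `n + 1`, every
reflection `r` lies in the interval `[1,w]`; that is, `ℓ(rw) = n` for every
reflection `r`. -/
theorem every_reflection_in_interval (n : ℕ) (w : Iso n)
    (hhyp : (0 : Euc n) ∉ MovSet n w)
    (hlen : reflLen n w = n + 1) :
    ∀ r : Iso n, IsReflection n r → inInterval n w r ∧ reflLen n (r * w) = n := by
  intro r hr
  refine ⟨?_, hr.reflLen_mul_of_reflLen_eq_succ hlen⟩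
  rw [inInterval, hr.reflLen_eq_one, hr.inv.reflLen_mul_of_reflLen_eq_succ hlen, hlen, add_comm]
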